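/- The function p ↦ K(p)·(p²·K(p) − K(p) + E(p)) is strictly increasing on (0,1): for all p, q with 0 < p < q < 1, K(p)·(p²·K(p) − K(p) + E(p)) < K(q)·(q²·K(q) − K(q) + E(q)). -/

import Mathlib

/-- Complete elliptic integral of the first kind. -/
noncomputable def ellipticK (p : ℝ) : ℝ :=
  ∫ z in (0:ℝ)..1, 1 / (Real.sqrt (1 - z ^ 2) * Real.sqrt (1 - p ^ 2 * z ^ 2))

/-- Complete elliptic integral of the second kind. -/
noncomputable def ellipticE (p : ℝ) : ℝ :=
  ∫ z in (0:ℝ)..1, Real.sqrt (1 - p ^ 2 * z ^ 2) / Real.sqrt (1 - z ^ 2)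

open Set MeasureTheory intervalIntegral

/-- The expression under the root of the elliptic modulus factor is positive on `[0, 1]`. -/
lemma one_sub_sq_mul_sq_pos {p z : ℝ} (hp : 0 < p) (hp1 : p < 1) (hz : z ∈ Icc (0 : ℝ) 1) :
    0 < 1 - p ^ 2 * z ^ 2 := by
  have h1 : p ^ 2 < 1 := by nlinarith
  have h2 : z ^ 2 ≤ 1 := by nlinarith [hz.1, hz.2]
  nlinarith [sq_nonneg z, sq_nonneg p]

/-- The weight `1 / √(1 - z²)` is integrable on `[0, 1]`, as the derivative of `arcsin`. -/
lemma intervalIntegrable_one_div_sqrt_one_sub_sq :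
    IntervalIntegrable (fun z : ℝ => 1 / Real.sqrt (1 - z ^ 2)) volume 0 1 := by
  refine intervalIntegral.intervalIntegrable_deriv_of_nonneg (g := Real.arcsin)
    Real.continuous_arcsin.continuousOn (fun z hz => ?_) (fun z _ => by positivity)
  simp only [zero_le_one, min_eq_left, max_eq_right, mem_Ioo] at hz
  exact Real.hasDerivAt_arcsin (by linarith [hz.1]) (by linarith [hz.2])

lemma continuousOn_inv_sqrt_one_sub_sq_mul_sq {p : ℝ} (hp : 0 < p) (hp1 : p < 1) :
    ContinuousOn (fun z : ℝ => (Real.sqrt (1 - p ^ 2 * z ^ 2))⁻¹) (uIcc 0 1) := by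
  rw [uIcc_of_le zero_le_one]
  refine ContinuousOn.inv₀ (by fun_prop) fun z hz => ?_
  exact (Real.sqrt_pos.2 (one_sub_sq_mul_sq_pos hp hp1 hz)).ne'

lemma intervalIntegrable_ellipticK {p : ℝ} (hp : 0 < p) (hp1 : p < 1) :
    IntervalIntegrable
      (fun z : ℝ => 1 / (Real.sqrt (1 - z ^ 2) * Real.sqrt (1 - p ^ 2 * z ^ 2))) volume 0 1 := by
  simpa only [one_div, mul_inv] using
    intervalIntegrable_one_div_sqrt_one_sub_sq.mul_continuousOn
      (continuousOn_inv_sqrt_one_sub_sq_mul_sq hp hp1)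

lemma intervalIntegrable_ellipticE (p : ℝ) :
    IntervalIntegrable
      (fun z : ℝ => Real.sqrt (1 - p ^ 2 * z ^ 2) / Real.sqrt (1 - z ^ 2)) volume 0 1 := by
  have h := intervalIntegrable_one_div_sqrt_one_sub_sq.continuousOn_mul
    (g := fun z : ℝ => Real.sqrt (1 - p ^ 2 * z ^ 2)) (by fun_prop)
  simpa only [mul_one_div] using h

lemma intervalIntegrable_sqrt_div_sqrt {p : ℝ} (hp : 0 < p) (hp1 : p < 1) :
    IntervalIntegrable
      (fun z : ℝ => Real.sqrt (1 - z ^ 2) / Real.sqrt (1 - p ^ 2 * z ^ 2)) volume 0 1 := by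
  refine ContinuousOn.intervalIntegrable ?_
  simp only [div_eq_mul_inv]
  exact ContinuousOn.mul (by fun_prop) (continuousOn_inv_sqrt_one_sub_sq_mul_sq hp hp1)

/-- The combination `p² K - K + E` is `p²` times an integral with monotone integrand. -/
lemma sq_mul_ellipticK_sub_add_ellipticE {p : ℝ} (hp : 0 < p) (hp1 : p < 1) :
    p ^ 2 * ellipticK p - ellipticK p + ellipticE p =
      p ^ 2 * ∫ z in (0 : ℝ)..1, Real.sqrt (1 - z ^ 2) / Real.sqrt (1 - p ^ 2 * z ^ 2) := by
  have hK := intervalIntegrable_ellipticK hp hp1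
  unfold ellipticK ellipticE
  rw [← intervalIntegral.integral_const_mul, ← intervalIntegral.integral_const_mul,
    ← intervalIntegral.integral_sub (hK.const_mul _) hK,
    ← intervalIntegral.integral_add ((hK.const_mul _).sub hK) (intervalIntegrable_ellipticE p)]
  refine intervalIntegral.integral_congr_Ioo_of_le zero_le_one fun z hz => ?_
  have ha : 0 < 1 - z ^ 2 := by nlinarith [hz.1, hz.2]
  have hb := one_sub_sq_mul_sq_pos hp hp1 (Ioo_subset_Icc_self hz)
  have ha' := Real.sqrt_pos.2 ha
  have hb' := Real.sqrt_pos.2 hb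
  have ha2 := Real.sq_sqrt ha.le
  have hb2 := Real.sq_sqrt hb.le
  field_simp
  rw [ha2, hb2]
  ring

lemma sqrt_one_sub_sq_mul_sq_anti {p q : ℝ} (hp : 0 < p) (hpq : p < q) (z : ℝ) :
    Real.sqrt (1 - q ^ 2 * z ^ 2) ≤ Real.sqrt (1 - p ^ 2 * z ^ 2) := by
  gcongr

lemma ellipticK_pos {p : ℝ} (hp : 0 < p) (hp1 : p < 1) : 0 < ellipticK p := by
  refine intervalIntegral_pos_of_pos_on (intervalIntegrable_ellipticK hp hp1)
    (fun z hz => ?_) one_pos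
  have ha : 0 < 1 - z ^ 2 := by nlinarith [hz.1, hz.2]
  have hb := one_sub_sq_mul_sq_pos hp hp1 (Ioo_subset_Icc_self hz)
  positivity

lemma ellipticK_mono {p q : ℝ} (hp : 0 < p) (hpq : p < q) (hq : q < 1) :
    ellipticK p ≤ ellipticK q := by
  refine integral_mono_on_of_le_Ioo zero_le_one (intervalIntegrable_ellipticK hp (hpq.trans hq))
    (intervalIntegrable_ellipticK (hp.trans hpq) hq) fun z hz => ?_
  have ha : 0 < 1 - z ^ 2 := by nlinarith [hz.1, hz.2]
  have hb := one_sub_sq_mul_sq_pos (hp.trans hpq) hq (Ioo_subset_Icc_self hz)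
  have := sqrt_one_sub_sq_mul_sq_anti hp hpq z
  gcongr

lemma integral_sqrt_div_sqrt_pos {p : ℝ} (hp : 0 < p) (hp1 : p < 1) :
    0 < ∫ z in (0 : ℝ)..1, Real.sqrt (1 - z ^ 2) / Real.sqrt (1 - p ^ 2 * z ^ 2) := by
  refine intervalIntegral_pos_of_pos_on (intervalIntegrable_sqrt_div_sqrt hp hp1)
    (fun z hz => ?_) one_pos
  have ha : 0 < 1 - z ^ 2 := by nlinarith [hz.1, hz.2]
  have hb := one_sub_sq_mul_sq_pos hp hp1 (Ioo_subset_Icc_self hz)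
  positivity

lemma integral_sqrt_div_sqrt_mono {p q : ℝ} (hp : 0 < p) (hpq : p < q) (hq : q < 1) :
    ∫ z in (0 : ℝ)..1, Real.sqrt (1 - z ^ 2) / Real.sqrt (1 - p ^ 2 * z ^ 2) ≤
      ∫ z in (0 : ℝ)..1, Real.sqrt (1 - z ^ 2) / Real.sqrt (1 - q ^ 2 * z ^ 2) := by
  refine integral_mono_on_of_le_Ioo zero_le_one
    (intervalIntegrable_sqrt_div_sqrt hp (hpq.trans hq))
    (intervalIntegrable_sqrt_div_sqrt (hp.trans hpq) hq) fun z hz => ?_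
  have hb := one_sub_sq_mul_sq_pos (hp.trans hpq) hq (Ioo_subset_Icc_self hz)
  have := sqrt_one_sub_sq_mul_sq_anti hp hpq z
  gcongr

theorem strictMono_K_mul_combination {p q : ℝ} (hp : 0 < p) (hpq : p < q) (hq : q < 1) :
    ellipticK p * (p ^ 2 * ellipticK p - ellipticK p + ellipticE p) <
      ellipticK q * (q ^ 2 * ellipticK q - ellipticK q + ellipticE q) := by
  have hp1 := hpq.trans hq
  rw [sq_mul_ellipticK_sub_add_ellipticE hp hp1,
    sq_mul_ellipticK_sub_add_ellipticE (hp.trans hpq) hq]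
  have hJ := integral_sqrt_div_sqrt_pos hp hp1
  have hsq : p ^ 2 < q ^ 2 := by gcongr
  exact mul_lt_mul' (ellipticK_mono hp hpq hq)
    (mul_lt_mul hsq (integral_sqrt_div_sqrt_mono hp hpq hq) hJ (sq_nonneg q))
    (by positivity) (ellipticK_pos (hp.trans hpq) hq)
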